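/- Let A ∈ SL(2, ℝ) and Λ_A = A·ℤ². The set of angles θ ∈ [0, 2π) such that sys(g_t·R_θ·Λ_A) → 0 as t → +∞ (i.e. the set of directions in which the torus ℝ²/Λ_A goes to infinity) is at most countable. -/

import Mathlib

open MeasureTheory Filter Topology Real

/-- The Euclidean norm of a vector in `ℝ²`. -/
noncomputable def vnorm (w : Fin 2 → ℝ) : ℝ := Real.sqrt (w 0 ^ 2 + w 1 ^ 2)

/-- The Teichmüller geodesic flow matrix `g_t = diag(e^t, e^{-t})`. -/
noncomputable def gmat (t : ℝ) : Matrix (Fin 2) (Fin 2) ℝ :=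
  !![Real.exp t, 0; 0, Real.exp (-t)]

/-- The rotation matrix `R_θ`. -/
noncomputable def rmat (θ : ℝ) : Matrix (Fin 2) (Fin 2) ℝ :=
  !![Real.cos θ, -Real.sin θ; Real.sin θ, Real.cos θ]

/-- The lattice `A·ℤ² ⊆ ℝ²`, image of `ℤ²` under `A`. -/
def latticeSet (A : Matrix (Fin 2) (Fin 2) ℝ) : Set (Fin 2 → ℝ) :=
  {w | ∃ q : Fin 2 → ℤ, w = A.mulVec fun i => (q i : ℝ)}

/-- The systole of a lattice `Λ ⊆ ℝ²`: the infimum of the Euclidean norms of its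
nonzero vectors. -/
noncomputable def sys (Λ : Set (Fin 2 → ℝ)) : ℝ :=
  sInf {r | ∃ w ∈ Λ, w ≠ 0 ∧ r = vnorm w}

section Lattice

variable {B M : Matrix (Fin 2) (Fin 2) ℝ}

theorem det_gmat (t : ℝ) : (gmat t).det = 1 := by
  simp [gmat, Matrix.det_fin_two, ← Real.exp_add]

theorem det_rmat (θ : ℝ) : (rmat θ).det = 1 := by
  rw [rmat, Matrix.det_fin_two_of]
  linarith [Real.sin_sq_add_cos_sq θ]

theorem exists_sq_lt_one_of_sys_lt_one (hM : M.det = 1) (h : sys (latticeSet M) < 1) :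
    ∃ q : Fin 2 → ℤ, q ≠ 0 ∧
      (M.mulVec fun i => (q i : ℝ)) 0 ^ 2 + (M.mulVec fun i => (q i : ℝ)) 1 ^ 2 < 1 := by
  have hne : {r | ∃ w ∈ latticeSet M, w ≠ 0 ∧ r = vnorm w}.Nonempty := by
    refine ⟨_, _, ⟨![1, 0], rfl⟩, fun h0 => ?_, rfl⟩
    have := congrFun (Matrix.eq_zero_of_mulVec_eq_zero (by simp [hM]) h0) 0
    simp at this
  obtain ⟨_, ⟨w, ⟨q, rfl⟩, hw, rfl⟩, hlt⟩ := exists_lt_of_csInf_lt hne h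
  refine ⟨q, ?_, ?_⟩
  · rintro rfl
    exact hw (by ext i; simp [Matrix.mulVec, dotProduct])
  · rw [vnorm, Real.sqrt_lt' one_pos] at hlt
    simpa using hlt

/-- Two lattice vectors of norm less than one in a unimodular lattice are collinear. -/
theorem collinear_of_sq_lt_one (hM : M.det = 1) {p q : Fin 2 → ℤ}
    (hp : (M.mulVec fun i => (p i : ℝ)) 0 ^ 2 + (M.mulVec fun i => (p i : ℝ)) 1 ^ 2 < 1)
    (hq : (M.mulVec fun i => (q i : ℝ)) 0 ^ 2 + (M.mulVec fun i => (q i : ℝ)) 1 ^ 2 < 1) :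
    p 0 * q 1 = p 1 * q 0 := by
  set u := M.mulVec fun i => (p i : ℝ) with hu
  set v := M.mulVec fun i => (q i : ℝ) with hv
  have hdet : u 0 * v 1 - u 1 * v 0 = ((p 0 * q 1 - p 1 * q 0 : ℤ) : ℝ) := by
    rw [Matrix.det_fin_two] at hM
    simp only [hu, hv, Matrix.mulVec, dotProduct, Fin.sum_univ_two]
    push_cast
    linear_combination ((p 0 : ℝ) * q 1 - p 1 * q 0) * hM
  have hsq : (u 0 * v 1 - u 1 * v 0) ^ 2 < 1 := by
    have hmul : (u 0 ^ 2 + u 1 ^ 2) * (v 0 ^ 2 + v 1 ^ 2) < 1 :=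
      mul_lt_one_of_nonneg_of_lt_one_left (by positivity) hp hq.le
    nlinarith [sq_nonneg (u 0 * v 0 + u 1 * v 1)]
  rw [hdet, sq_lt_one_iff_abs_lt_one] at hsq
  exact sub_eq_zero.1 (Int.abs_lt_one_iff.1 (by exact_mod_cast hsq))

theorem collinear_trans {p q r : Fin 2 → ℤ} (hq : q ≠ 0)
    (hpq : p 0 * q 1 = p 1 * q 0) (hqr : q 0 * r 1 = q 1 * r 0) :
    p 0 * r 1 = p 1 * r 0 := by
  by_cases h0 : q 0 = 0
  · have h1 : q 1 ≠ 0 := fun h1 => hq (by ext i; fin_cases i <;> simp [h0, h1])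
    exact mul_left_cancel₀ h1 (by linear_combination r 1 * hpq + p 1 * hqr)
  · exact mul_left_cancel₀ h0 (by linear_combination r 0 * hpq + p 0 * hqr)

/-- If `p` is collinear with a nonzero integer vector `q`, then the coordinates of the image of `p`
are bounded by a multiple, depending only on `p`, of those of the image of `q`. -/
theorem abs_mulVec_le_of_collinear {p q : Fin 2 → ℤ} (hq : q ≠ 0)
    (hpq : p 0 * q 1 = p 1 * q 0) (i : Fin 2) :
    |(B.mulVec fun j => (p j : ℝ)) i| ≤
      (|(p 0 : ℝ)| + |(p 1 : ℝ)|) * |(B.mulVec fun j => (q j : ℝ)) i| := by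
  have key : ∀ j, |(B.mulVec fun j => (p j : ℝ)) i| * |(q j : ℝ)| =
      |(p j : ℝ)| * |(B.mulVec fun j => (q j : ℝ)) i| := by
    have hpq' : (p 0 : ℝ) * q 1 = p 1 * q 0 := by exact_mod_cast hpq
    intro j
    rw [← abs_mul, ← abs_mul]
    congr 1
    simp only [Matrix.mulVec, dotProduct, Fin.sum_univ_two]
    fin_cases j
    · simp only [Fin.zero_eta]
      linear_combination -B i 1 * hpq'
    · simp only [Fin.mk_one]
      linear_combination B i 0 * hpq'
  obtain ⟨j, hj⟩ := Function.ne_iff.1 hq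
  have hj1 : (1 : ℝ) ≤ |(q j : ℝ)| := by exact_mod_cast Int.one_le_abs hj
  have hle : |(p j : ℝ)| ≤ |(p 0 : ℝ)| + |(p 1 : ℝ)| := by
    fin_cases j <;> simp
  calc |(B.mulVec fun j => (p j : ℝ)) i|
      ≤ |(B.mulVec fun j => (p j : ℝ)) i| * |(q j : ℝ)| :=
        le_mul_of_one_le_right (abs_nonneg _) hj1
    _ = |(p j : ℝ)| * |(B.mulVec fun j => (q j : ℝ)) i| := key j
    _ ≤ _ := mul_le_mul_of_nonneg_right hle (abs_nonneg _)

theorem gmat_mul_mulVec_zero (t : ℝ) (w : Fin 2 → ℝ) :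
    ((gmat t * B).mulVec w) 0 = Real.exp t * (B.mulVec w) 0 := by
  rw [← Matrix.mulVec_mulVec]
  simp [gmat, Matrix.mulVec, dotProduct, Fin.sum_univ_two]

theorem gmat_mul_mulVec_one (t : ℝ) (w : Fin 2 → ℝ) :
    ((gmat t * B).mulVec w) 1 = Real.exp (-t) * (B.mulVec w) 1 := by
  rw [← Matrix.mulVec_mulVec]
  simp [gmat, Matrix.mulVec, dotProduct, Fin.sum_univ_two]

/-- If the forward orbit of a unimodular lattice under `g_t` diverges, then the lattice contains a
nonzero vertical vector. -/
theorem exists_vertical_of_tendsto_sys (hB : B.det = 1)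
    (h : Tendsto (fun t : ℝ => sys (latticeSet (gmat t * B))) atTop (𝓝 0)) :
    ∃ q : Fin 2 → ℤ, q ≠ 0 ∧ (B.mulVec fun i => (q i : ℝ)) 0 = 0 := by
  have hdet : ∀ t, (gmat t * B).det = 1 := fun t => by rw [Matrix.det_mul, det_gmat, hB, one_mul]
  obtain ⟨T, hT⟩ := eventually_atTop.1 (h.eventually_lt_const one_pos)
  let U : (Fin 2 → ℤ) → Set ℝ := fun q =>
    {t | ((gmat t * B).mulVec fun i => (q i : ℝ)) 0 ^ 2 +
      ((gmat t * B).mulVec fun i => (q i : ℝ)) 1 ^ 2 < 1}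
  have hU : ∀ q, IsOpen (U q) := fun q => by
    simp only [U, gmat_mul_mulVec_zero, gmat_mul_mulVec_one]
    exact isOpen_lt (by fun_prop) continuous_const
  have hcover : ∀ t, T ≤ t → ∃ q : Fin 2 → ℤ, q ≠ 0 ∧ t ∈ U q := fun t ht =>
    exists_sq_lt_one_of_sys_lt_one (hdet t) (hT t ht)
  obtain ⟨p, hp, hpT⟩ := hcover T le_rfl
  have hsub : Set.Ici T ⊆ ⋃ q ∈ {q : Fin 2 → ℤ | q ≠ 0 ∧ p 0 * q 1 = p 1 * q 0}, U q := by
    refine isPreconnected_Ici.subset_left_of_subset_union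
      (v := ⋃ q ∈ {q : Fin 2 → ℤ | p 0 * q 1 ≠ p 1 * q 0}, U q)
      (isOpen_biUnion fun q _ => hU q) (isOpen_biUnion fun q _ => hU q) ?_ ?_ ?_
    · simp only [Set.disjoint_left, Set.mem_iUnion, not_exists]
      rintro t ⟨q, ⟨hq, hpq⟩, htq⟩ r hpr htr
      exact hpr (collinear_trans hq hpq (collinear_of_sq_lt_one (hdet t) htq htr))
    · intro t ht
      obtain ⟨q, hq, htq⟩ := hcover t ht
      by_cases hpq : p 0 * q 1 = p 1 * q 0
      · exact Or.inl (Set.mem_biUnion (show q ∈ {q | _} from ⟨hq, hpq⟩) htq)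
      · exact Or.inr (Set.mem_biUnion (show q ∈ {q | _} from hpq) htq)
    · exact ⟨T, Set.self_mem_Ici, Set.mem_biUnion (show p ∈ {q | _} from ⟨hp, mul_comm _ _⟩) hpT⟩
  refine ⟨p, hp, ?_⟩
  have hbound : ∀ t, T ≤ t → |(B.mulVec fun i => (p i : ℝ)) 0| ≤
      (|(p 0 : ℝ)| + |(p 1 : ℝ)|) * Real.exp (-t) := by
    intro t ht
    obtain ⟨q, ⟨hq, hpq⟩, htq⟩ := Set.mem_iUnion₂.1 (hsub ht)
    refine (abs_mulVec_le_of_collinear hq hpq 0).trans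
      (mul_le_mul_of_nonneg_left ?_ (by positivity))
    have hlt : (Real.exp t * (B.mulVec fun i => (q i : ℝ)) 0) ^ 2 < 1 := by
      rw [← gmat_mul_mulVec_zero]
      exact (le_add_of_nonneg_right (sq_nonneg _)).trans_lt htq
    rw [sq_lt_one_iff_abs_lt_one, abs_mul, Real.abs_exp] at hlt
    rw [Real.exp_neg, ← one_div, le_div_iff₀' (Real.exp_pos t)]
    exact hlt.le
  have hlim : Tendsto (fun t : ℝ => (|(p 0 : ℝ)| + |(p 1 : ℝ)|) * Real.exp (-t)) atTop (𝓝 0) := by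
    simpa using (Real.tendsto_exp_neg_atTop_nhds_zero).const_mul (|(p 0 : ℝ)| + |(p 1 : ℝ)|)
  exact abs_nonpos_iff.1 (ge_of_tendsto hlim (eventually_atTop.2 ⟨T, hbound⟩))

end Lattice

theorem countable_setOf_cos_mul_sub_sin_mul_eq_zero {a b : ℝ} (h : a ≠ 0 ∨ b ≠ 0) :
    {θ : ℝ | Real.cos θ * a - Real.sin θ * b = 0}.Countable := by
  set z : ℂ := ⟨b, a⟩
  have hz : z ≠ 0 := fun hz => by
    have h1 := congrArg Complex.re hz
    have h2 := congrArg Complex.im hz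
    simp_all [z]
  have hb : ‖z‖ * Real.cos z.arg = b := Complex.norm_mul_cos_arg z
  have ha : ‖z‖ * Real.sin z.arg = a := Complex.norm_mul_sin_arg z
  refine (Set.countable_range fun n : ℤ => z.arg - n * π).mono fun θ hθ => ?_
  have hsin : Real.sin (z.arg - θ) = 0 := by
    refine (mul_eq_zero.1 (?_ : ‖z‖ * Real.sin (z.arg - θ) = 0)).resolve_left (norm_ne_zero_iff.2 hz)
    rw [Real.sin_sub]
    have hθ' : Real.cos θ * a - Real.sin θ * b = 0 := hθ
    linear_combination Real.cos θ * ha - Real.sin θ * hb + hθ'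
  obtain ⟨n, hn⟩ := Real.sin_eq_zero_iff.1 hsin
  exact ⟨n, by simp only [hn]; ring⟩

/-- For `A ∈ SL(2, ℝ)`, the set of angles `θ ∈ [0, 2π)` such that
`sys(g_t·R_θ·Λ_A) → 0` as `t → +∞` (the set of directions in which the torus
`ℝ²/Λ_A` goes to infinity) is at most countable. -/
theorem countable_divergent_directions
    (A : Matrix (Fin 2) (Fin 2) ℝ) (hA : A.det = 1) :
    {θ ∈ Set.Ico (0 : ℝ) (2 * π) |
      Tendsto (fun t : ℝ => sys (latticeSet (gmat t * rmat θ * A))) atTop (𝓝 0)}.Countable := by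
  have hcount : (⋃ q ∈ {q : Fin 2 → ℤ | q ≠ 0},
      {θ : ℝ | Real.cos θ * (A.mulVec fun i => (q i : ℝ)) 0 -
        Real.sin θ * (A.mulVec fun i => (q i : ℝ)) 1 = 0}).Countable := by
    refine (Set.to_countable _).biUnion fun q hq =>
      countable_setOf_cos_mul_sub_sin_mul_eq_zero ?_
    by_contra! h0
    refine hq ?_
    have hker := Matrix.eq_zero_of_mulVec_eq_zero (M := A) (v := fun i => (q i : ℝ))
      (by simp [hA]) (by ext i; fin_cases i; exacts [h0.1, h0.2])
    ext i
    simpa using congrFun hker i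
  refine hcount.mono ?_
  rintro θ ⟨-, hθ⟩
  simp only [Matrix.mul_assoc] at hθ
  obtain ⟨q, hq, h0⟩ := exists_vertical_of_tendsto_sys
    (by rw [Matrix.det_mul, det_rmat, hA, one_mul]) hθ
  refine Set.mem_biUnion (show q ∈ {q | _} from hq) ?_
  rw [← Matrix.mulVec_mulVec] at h0
  generalize A.mulVec (fun i => (q i : ℝ)) = w at h0 ⊢
  simpa [rmat, Matrix.mulVec, dotProduct, Fin.sum_univ_two, sub_eq_add_neg] using h0
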